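/- arXiv:2312.09101 — 3 statements merged into one kernel-verified Lean document; each statement's English description precedes it below -/
import Mathlib

section
/- Let G = (X,E) be a tree, z ∈ ℂ, and f ∈ E_z(Δᵉ; Maps(E,ℂ)). For a vertex x ∈ X let E_x denote the set of edges pointing away from x. Then for every edge e ∈ E ∖ E_x, writing (e₁ = e, e₂, …, e_n) for the edges on the unique path from ι(e) to x (so n = d(ι(e), x) and τ(e_n) = x), one has z^n·f(e) = (z² − 1)·Σ_{k=2}^{n} z^{n−k}·f(ē_k) − z^{n−1}·f(ē) + Σ_{e' ∈ E, ι(e') = x} f(e'). -/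
open Function Set
open scoped Classical

namespace GraphQCC

variable {X : Type} (G : SimpleGraph X)

/-- The set of directed edges of a (symmetric, loopless) graph. -/
abbrev DE := {p : X × X // G.Adj p.1 p.2}

variable {G}

/-- Initial vertex of a directed edge. -/
def ini (e : DE G) : X := e.1.1

/-- Terminal vertex of a directed edge. -/
def ter (e : DE G) : X := e.1.2

/-- Opposite edge. -/
def op (e : DE G) : DE G := ⟨(e.1.2, e.1.1), e.2.symm⟩

variable (G)

/-- Degree of a vertex: the number of directed edges starting at it. -/
noncomputable def deg (x : X) : ℕ := Set.ncard {e : DE G | ini e = x}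

/-- The graph is locally finite: every vertex has finite degree. -/
def LocFin : Prop := ∀ x : X, {e : DE G | ini e = x}.Finite

/-- The edge Laplacian. -/
noncomputable def edgeLap (f : DE G → ℂ) (e : DE G) : ℂ :=
  ∑ᶠ e' ∈ {e' : DE G | ini e' = ter e ∧ e' ≠ op e}, f e'

/-- The `z`-eigenspace of the edge Laplacian, as a set of functions on directed edges. -/
def edgeEig (z : ℂ) : Set (DE G → ℂ) := {f | ∀ e, edgeLap G f e = z * f e}

/-- The edge inversion operator Ξ. -/
def Xi (f : DE G → ℂ) (e : DE G) : ℂ := f (op e)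

/-- The operator Σ (sum over edges with the same initial point). -/
noncomputable def Sig (f : DE G → ℂ) (e : DE G) : ℂ :=
  ∑ᶠ e' ∈ {e' : DE G | ini e' = ini e}, f e'

/-- Edges pointing away from a vertex `o`. -/
def away (o : X) : Set (DE G) := {e | G.dist o (ter e) = G.dist o (ini e) + 1}

/-- The edge Laplacian on functions on the edges pointing away from `o`. -/
noncomputable def edgeLapAway (o : X) (f : ↥(away G o) → ℂ) (e : ↥(away G o)) : ℂ :=
  ∑ᶠ e' ∈ {e' : ↥(away G o) | ini e'.1 = ter e.1 ∧ e'.1 ≠ op e.1}, f e'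

/-- The `z`-eigenspace of the edge Laplacian on edges pointing away from `o`. -/
def edgeEigAway (o : X) (z : ℂ) : Set (↥(away G o) → ℂ) :=
  {f | ∀ e, edgeLapAway G o f e = z * f e}

/-! ## Boundary at infinity -/

/-- A ray: an infinite non-backtracking chain of vertices. -/
def IsRay (r : ℕ → X) : Prop := (∀ n, G.Adj (r n) (r (n + 1))) ∧ ∀ n, r (n + 2) ≠ r n

abbrev Ray := {r : ℕ → X // IsRay G r}

/-- Two rays are equivalent if they share infinitely many vertices. -/
def RayRel (r r' : Ray G) : Prop := (Set.range r.1 ∩ Set.range r'.1).Infinite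

/-- The boundary at infinity: equivalence classes of rays. -/
def Boundary := Quot (RayRel G)

/-- The set `∂₊ e` of boundary points reachable by a non-backtracking chain starting with `e`. -/
def plusBd (e : DE G) : Set (Boundary G) :=
  {ω | ∃ r : Ray G, Quot.mk (RayRel G) r = ω ∧ r.1 0 = ini e ∧ r.1 1 = ter e}

/-- The topology on the boundary generated by the sets `∂₊ e`. -/
instance : TopologicalSpace (Boundary G) :=
  TopologicalSpace.generateFrom {s | ∃ e : DE G, s = plusBd G e}

/-- The space of locally constant functions on the boundary. -/
noncomputable def Clc : Submodule ℂ (Boundary G → ℂ) where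
  carrier := {f | IsLocallyConstant f}
  add_mem' hf hg := hf.comp₂ hg (· + ·)
  zero_mem' := IsLocallyConstant.const 0
  smul_mem' c f hf := hf.comp (c * ·)

/-- `D'(Ω)`: the algebraic dual of the space of locally constant functions on the boundary. -/
abbrev DualB := Module.Dual ℂ ↥(Clc G)

/-- Pairing of a functional on `C^lc(Ω)` with a function on the boundary. -/
noncomputable def pairB (μ : DualB G) (g : Boundary G → ℂ) : ℂ :=
  if h : IsLocallyConstant g then μ ⟨g, h⟩ else 0

/-- The horocycle bracket `⟨x, ω⟩` with respect to the base point `o`: the unique integer `k`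
such that `d(x, r n) = n - k` for every ray `r` from `o` representing `ω` and all large `n`. -/
noncomputable def horo (o x : X) (ω : Boundary G) : ℤ :=
  if h : ∃ k : ℤ, ∀ r : Ray G, Quot.mk (RayRel G) r = ω → r.1 0 = o →
      ∃ N : ℕ, ∀ n : ℕ, N ≤ n → (G.dist x (r.1 n) : ℤ) = (n : ℤ) - k
  then h.choose else 0

/-- The scalar Poisson transform. -/
noncomputable def poisson (o : X) (z : ℂ) (μ : DualB G) (x : X) : ℂ :=
  pairB G μ fun ω => z ^ horo G o x ω

/-- The edge Poisson transform. -/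
noncomputable def edgePoisson (o : X) (z : ℂ) (μ : DualB G) (e : DE G) : ℂ :=
  pairB G μ fun ω => z ^ horo G o (ini e) ω * Set.indicator (plusBd G e) 1 ω

/-! ## The shift space of non-backtracking chains of edges -/

/-- An infinite concatenated non-backtracking sequence of directed edges. -/
def IsChainSeq (c : ℕ → DE G) : Prop :=
  ∀ i, ter (c i) = ini (c (i + 1)) ∧ ter (c (i + 1)) ≠ ini (c i)

/-- The shift space `𝔓`. -/
abbrev ChainSp := {c : ℕ → DE G // IsChainSeq G c}

/-- The one-sided shift on chains. -/
def shift (c : ChainSp G) : ChainSp G := ⟨fun n => c.1 (n + 1), fun i => c.2 (i + 1)⟩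

/-- The district (cylinder) topology on the shift space. -/
instance : TopologicalSpace (ChainSp G) :=
  TopologicalSpace.generateFrom
    {s | ∃ (c₀ : ChainSp G) (n : ℕ), s = {c : ChainSp G | ∀ i ≤ n, c.1 i = c₀.1 i}}

/-- The Ruelle transfer operator. -/
noncomputable def transfer (F : ChainSp G → ℂ) (c : ChainSp G) : ℂ :=
  ∑ᶠ c' ∈ {c' : ChainSp G | shift G c' = c}, F c'

/-- Functions on chains depending only on the first `N` edges. -/
def cylFun (N : ℕ) : Set (ChainSp G → ℂ) :=
  {F | ∀ c c' : ChainSp G, (∀ i < N, c.1 i = c'.1 i) → F c = F c'}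

/-- The ray of initial vertices of a chain of edges. -/
def toRay (c : ChainSp G) : Ray G :=
  ⟨fun n => ini (c.1 n), by
    refine ⟨fun n => ?_, fun n => ?_⟩
    · have h1 : ter (c.1 n) = ini (c.1 (n + 1)) := (c.2 n).1
      have h2 : G.Adj (ini (c.1 n)) (ter (c.1 n)) := (c.1 n).2
      rwa [h1] at h2
    · have h1 : ter (c.1 (n + 1)) = ini (c.1 (n + 2)) := (c.2 (n + 1)).1
      have h2 : ter (c.1 (n + 1)) ≠ ini (c.1 n) := (c.2 n).2
      rwa [h1] at h2⟩

/-- The endpoint map `B : 𝔓 → Ω`. -/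
def endB (c : ChainSp G) : Boundary G := Quot.mk (RayRel G) (toRay G c)

/-- The pushforward `B_⋆` by fiber summation. -/
noncomputable def push (f : ChainSp G → ℂ) (ω : Boundary G) : ℂ :=
  ∑ᶠ c ∈ {c : ChainSp G | endB G c = ω}, f c

/-- The space of locally constant compactly supported functions on the shift space. -/
noncomputable def CcP : Submodule ℂ (ChainSp G → ℂ) where
  carrier := {F | IsLocallyConstant F ∧ HasCompactSupport F}
  add_mem' hf hg := ⟨hf.1.comp₂ hg.1 (· + ·), hf.2.add hg.2⟩
  zero_mem' := ⟨IsLocallyConstant.const 0, HasCompactSupport.zero⟩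
  smul_mem' c f hf := ⟨hf.1.comp (c * ·),
    hf.2.mono fun x hx h0 => hx (by simp [h0])⟩

/-- `D'(𝔓)`: the algebraic dual of `C^lc_c(𝔓)`. -/
abbrev DualP := Module.Dual ℂ ↥(CcP G)

/-- Pairing of a functional on `C^lc_c(𝔓)` with a function on the shift space. -/
noncomputable def pairP (lam : DualP G) (g : ChainSp G → ℂ) : ℂ :=
  if h : g ∈ CcP G then lam ⟨g, h⟩ else 0

/-- The space of locally constant functions on the shift space (for finite graphs this is
`C^lc_c(𝔓)` since `𝔓` is compact). -/
noncomputable def ClcP : Submodule ℂ (ChainSp G → ℂ) where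
  carrier := {F | IsLocallyConstant F}
  add_mem' hf hg := hf.comp₂ hg (· + ·)
  zero_mem' := IsLocallyConstant.const 0
  smul_mem' c f hf := hf.comp (c * ·)

/-- The dual of `C^lc(𝔓)`. -/
abbrev DualPc := Module.Dual ℂ ↥(ClcP G)

/-- Pairing of a functional on `C^lc(𝔓)` with a function on the shift space. -/
noncomputable def pairPc (lam : DualPc G) (g : ChainSp G → ℂ) : ℂ :=
  if h : IsLocallyConstant g then lam ⟨g, h⟩ else 0

/-! ## Vertex Laplacian -/

/-- The vertex Laplacian (averaging over neighbors). -/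
noncomputable def vertexLap (f : X → ℂ) (x : X) : ℂ :=
  ((deg G x : ℂ))⁻¹ * ∑ᶠ e ∈ {e : DE G | ini e = x}, f (ter e)

/-- The function `χ(z)(x) = (z + q_x z⁻¹)/(q_x + 1)`. -/
noncomputable def chi (z : ℂ) (x : X) : ℂ :=
  (z + ((deg G x : ℂ) - 1) * z⁻¹) / (deg G x : ℂ)

/-- The `χ(z)`-eigenspace of the vertex Laplacian. -/
def vertexEig (z : ℂ) : Set (X → ℂ) := {f | ∀ x, vertexLap G f x = chi G z x * f x}

/-! ## Miscellaneous -/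

/-- Two subsets of complex vector spaces (in practice: subspaces) are linearly isomorphic. -/
def AreLinIso {M N : Type} [AddCommMonoid M] [Module ℂ M] [AddCommMonoid N] [Module ℂ N]
    (A : Set M) (B : Set N) : Prop :=
  ∃ F : M → N, Set.BijOn F A B ∧ (∀ a ∈ A, ∀ b ∈ A, F (a + b) = F a + F b) ∧
    ∀ (c : ℂ), ∀ a ∈ A, F (c • a) = c • F a

/-- The `z`-eigenspace of the edge Laplacian as a submodule (for a locally finite graph). -/
noncomputable def edgeEigSub (hlf : LocFin G) (z : ℂ) : Submodule ℂ (DE G → ℂ) where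
  carrier := edgeEig G z
  add_mem' := by
    intro f g hf hg e
    have hS : {e' : DE G | ini e' = ter e ∧ e' ≠ op e}.Finite :=
      (hlf (ter e)).subset fun _ h => h.1
    have : edgeLap G (f + g) e = edgeLap G f e + edgeLap G g e := by
      simpa [edgeLap] using finsum_mem_add_distrib (f := f) (g := g) hS
    rw [this, hf e, hg e, Pi.add_apply, mul_add]
  zero_mem' := by
    intro e
    simp [edgeLap]
  smul_mem' := by
    intro c f hf e
    have hS : {e' : DE G | ini e' = ter e ∧ e' ≠ op e}.Finite :=
      (hlf (ter e)).subset fun _ h => h.1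
    have : edgeLap G (c • f) e = c * edgeLap G f e := by
      simp only [edgeLap, Pi.smul_apply, smul_eq_mul]
      rw [finsum_mem_eq_finite_toFinset_sum _ hS, finsum_mem_eq_finite_toFinset_sum _ hS,
        Finset.mul_sum]
    rw [Pi.smul_apply, smul_eq_mul, this, hf e]; ring

/-- The cyclomatic number of a finite graph, as an integer. -/
noncomputable def cyclo : ℤ := (Nat.card G.edgeSet : ℤ) - (Nat.card X : ℤ) + 1

/-- 2-colorability. -/
def TwoColorable : Prop := ∃ col : X → Bool, ∀ x y : X, G.Adj x y → col x ≠ col y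


/-- An edge Laplacian eigenfunction expressed through the full sum at a terminal vertex. -/
theorem finsum_ini_eq_of_mem_edgeEig {X : Type} {G : SimpleGraph X} (hlf : LocFin G)
    {z : ℂ} {f : DE G → ℂ} (hf : f ∈ edgeEig G z) (e : DE G) :
    ∑ᶠ e' ∈ {e' : DE G | ini e' = ter e}, f e' = z * f e + f (op e) := by
  have hset : {e' : DE G | ini e' = ter e} =
      insert (op e) {e' : DE G | ini e' = ter e ∧ e' ≠ op e} := by
    ext e'
    simp only [mem_ofPred_eq, mem_insert_iff]
    refine ⟨fun h => ?_, ?_⟩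
    · by_cases h' : e' = op e <;> simp [h, h']
    · rintro (rfl | h)
      exacts [rfl, h.1]
  rw [hset, finsum_mem_insert _ (by simp) ((hlf (ter e)).subset fun _ h => h.1), ← hf e,
    edgeLap, add_comm]

/-- The expansion of an eigenfunction along a chain of concatenated edges. -/
theorem pow_mul_eq_of_chain {X : Type} {G : SimpleGraph X} (hlf : LocFin G)
    {z : ℂ} {f : DE G → ℂ} (hf : f ∈ edgeEig G z) (p : ℕ → DE G) (m : ℕ)
    (hcat : ∀ i : ℕ, 1 ≤ i → i < m + 1 → ter (p i) = ini (p (i + 1))) :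
    z ^ (m + 1) * f (p 1) =
      (z ^ 2 - 1) * (∑ k ∈ Finset.Icc 2 (m + 1), z ^ (m + 1 - k) * f (op (p k))) -
        z ^ m * f (op (p 1)) + ∑ᶠ e' ∈ {e' : DE G | ini e' = ter (p (m + 1))}, f e' := by
  induction m with
  | zero =>
    rw [finsum_ini_eq_of_mem_edgeEig hlf hf]
    simp
  | succ m ih =>
    have hI := ih fun i h1 h2 => hcat i h1 (by omega)
    have hS := finsum_ini_eq_of_mem_edgeEig hlf hf (op (p (m + 2)))
    rw [show ter (op (p (m + 2))) = ter (p (m + 1)) from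
      (hcat (m + 1) (by omega) (by omega)).symm, show op (op (p (m + 2))) = p (m + 2) from rfl]
      at hS
    rw [hS] at hI
    have hsum : ∑ k ∈ Finset.Icc 2 (m + 1), z ^ (m + 2 - k) * f (op (p k)) =
        z * ∑ k ∈ Finset.Icc 2 (m + 1), z ^ (m + 1 - k) * f (op (p k)) := by
      rw [Finset.mul_sum]
      refine Finset.sum_congr rfl fun k hk => ?_
      rw [show m + 2 - k = m + 1 - k + 1 by grind, pow_succ]
      ring
    rw [Finset.sum_Icc_succ_top (by omega), hsum, finsum_ini_eq_of_mem_edgeEig hlf hf, Nat.sub_self]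
    linear_combination z * hI

/-- The value of an edge Laplacian eigenfunction on an edge not pointing
away from `x`, in terms of the edges of the path from `ι e` to `x`. -/
theorem statement4 {X : Type} (G : SimpleGraph X) (hT : G.IsTree) (hlf : LocFin G)
    (z : ℂ) (f : DE G → ℂ) (hf : f ∈ edgeEig G z) (x : X) (e : DE G) (he : e ∉ away G x)
    (n : ℕ) (hn : n = G.dist (ini e) x) (p : ℕ → DE G) (hp1 : p 1 = e)
    (hcat : ∀ i : ℕ, 1 ≤ i → i < n → ter (p i) = ini (p (i + 1)))
    (hlast : ter (p n) = x) :
    z ^ n * f e =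
      (z ^ 2 - 1) * (∑ k ∈ Finset.Icc 2 n, z ^ (n - k) * f (op (p k))) -
        z ^ (n - 1) * f (op e) + ∑ᶠ e' ∈ {e' : DE G | ini e' = x}, f e' := by
  obtain _ | m := n
  · have hx : ini e = x := (hT.connected.dist_eq_zero_iff).1 hn.symm
    refine absurd ?_ he
    have h1 : G.dist (ini e) (ter e) = 1 := SimpleGraph.dist_eq_one_iff_adj.2 e.2
    simp [away, ← hx, h1]
  · subst hp1 hlast
    exact pow_mul_eq_of_chain hlf hf p m hcat

end GraphQCC
end

section
/- Let G = (X,E) be a tree of bounded degree without dead ends, with base point o ∈ X, and let z ∈ ℂ ∖ {0}. Then the restriction map f ↦ f|_{E_o} is a linear isomorphism from E_z(Δᵉ; Maps(E,ℂ)) onto E_z(Δᵉ; Maps(E_o,ℂ)); in other words, every Δᵉ-eigenfunction with eigenvalue z on the edges pointing away from o extends uniquely to a Δᵉ-eigenfunction with eigenvalue z on all of E. -/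
open Function Set
open scoped Classical

namespace GraphQCC

variable {X : Type} (G : SimpleGraph X)

variable {G}

variable (G)

variable {G}

lemma dist_ini_eq_of_notMem_away (hT : G.IsTree) {o : X} {e : DE G} (he : e ∉ away G o) :
    G.dist o (ini e) = G.dist o (ter e) + 1 :=
  (hT.dist_eq_dist_add_one_of_adj o e.2).resolve_right he

lemma eq_of_adj_of_dist_eq (hT : G.IsTree) {o u v w : X} (hu : G.Adj u v) (hw : G.Adj w v)
    (hdu : G.dist o v = G.dist o u + 1) (hdw : G.dist o v = G.dist o w + 1) : u = w := by
  obtain ⟨p, hp⟩ := hT.connected.exists_walk_length_eq_dist o u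
  obtain ⟨q, hq⟩ := hT.connected.exists_walk_length_eq_dist o w
  have hp' : (p.concat hu).IsPath := SimpleGraph.Walk.isPath_of_length_eq_dist _ (by simp [*])
  have hq' : (q.concat hw).IsPath :=
    SimpleGraph.Walk.isPath_of_length_eq_dist _ (by simp [hq, hdw])
  have h := congrArg SimpleGraph.Walk.penultimate ((hT.existsUnique_path o v).unique hp' hq')
  simpa using h

lemma mem_away_of_follows (hT : G.IsTree) {o : X} {e e' : DE G} (he : e ∈ away G o)
    (h : ini e' = ter e) (hne : e' ≠ op e) : e' ∈ away G o := by
  by_contra he'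
  have hd := dist_ini_eq_of_notMem_away hT he'
  have hadj : G.Adj (ter e') (ter e) := h ▸ e'.2.symm
  rw [h] at hd
  have ht : ini e = ter e' := eq_of_adj_of_dist_eq hT e.2 hadj he hd
  exact hne (Subtype.ext (Prod.ext h ht.symm))

lemma edgeLapAway_restrict (hT : G.IsTree) (o : X) (f : DE G → ℂ) (e : ↥(away G o)) :
    edgeLapAway G o (fun e' => f e'.1) e = edgeLap G f e.1 :=
  finsum_mem_eq_of_bijOn Subtype.val
    ⟨fun _ h => h, Subtype.val_injective.injOn,
      fun e' h => ⟨⟨e', mem_away_of_follows hT e.2 h.1 h.2⟩, h, rfl⟩⟩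
    fun _ _ => rfl

lemma edgeLap_congr {f g : DE G → ℂ} {e : DE G} (h : ∀ e', ini e' = ter e → f e' = g e') :
    edgeLap G f e = edgeLap G g e :=
  finsum_mem_congr rfl fun e' he' => h e' he'.1

lemma injOn_restrict_away (hT : G.IsTree) (o : X) {z : ℂ} (hz : z ≠ 0) :
    Set.InjOn (fun (f : DE G → ℂ) (e : ↥(away G o)) => f e.1) (edgeEig G z) := by
  intro f hf g hg hfg
  have key : ∀ n, ∀ e : DE G, G.dist o (ini e) ≤ n → f e = g e := by
    intro n
    induction n with
    | zero =>
      intro e he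
      by_cases hm : e ∈ away G o
      · exact congrFun hfg ⟨e, hm⟩
      · have := dist_ini_eq_of_notMem_away hT hm
        omega
    | succ n ih =>
      intro e he
      by_cases hm : e ∈ away G o
      · exact congrFun hfg ⟨e, hm⟩
      · have := dist_ini_eq_of_notMem_away hT hm
        apply mul_left_cancel₀ hz
        rw [← hf e, ← hg e]
        exact edgeLap_congr fun e' he' => ih e' (by rw [he']; omega)
  exact funext fun e => key _ e le_rfl

variable (G) in
/-- The extension of `g` to a `z`-eigenfunction on all edges agrees with `extendAux G o z g n` on
the edges starting at distance `n` from `o`. -/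
noncomputable def extendAux (o : X) (z : ℂ) (g : ↥(away G o) → ℂ) : ℕ → DE G → ℂ
  | 0, e => if h : e ∈ away G o then g ⟨e, h⟩ else 0
  | n + 1, e => if h : e ∈ away G o then g ⟨e, h⟩ else z⁻¹ * edgeLap G (extendAux o z g n) e

lemma extendAux_of_mem {o : X} (z : ℂ) (g : ↥(away G o) → ℂ) (n : ℕ) {e : DE G}
    (h : e ∈ away G o) : extendAux G o z g n e = g ⟨e, h⟩ := by
  cases n <;> simp [extendAux, h]

lemma extendAux_succ_of_notMem {o : X} (z : ℂ) (g : ↥(away G o) → ℂ) (n : ℕ) {e : DE G}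
    (h : e ∉ away G o) :
    extendAux G o z g (n + 1) e = z⁻¹ * edgeLap G (extendAux G o z g n) e := by
  simp [extendAux, h]

lemma surjOn_restrict_away (hT : G.IsTree) (o : X) {z : ℂ} (hz : z ≠ 0) :
    Set.SurjOn (fun (f : DE G → ℂ) (e : ↥(away G o)) => f e.1)
      (edgeEig G z) (edgeEigAway G o z) := by
  intro g hg
  set f : DE G → ℂ := fun e => extendAux G o z g (G.dist o (ini e)) e
  have hfg : (fun e : ↥(away G o) => f e.1) = g := funext fun e => extendAux_of_mem z g _ e.2
  refine ⟨f, fun e => ?_, hfg⟩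
  by_cases hm : e ∈ away G o
  · rw [← edgeLapAway_restrict hT o f ⟨e, hm⟩, hfg, hg ⟨e, hm⟩, ← hfg]
  · have hd := dist_ini_eq_of_notMem_away hT hm
    have hfe : f e = z⁻¹ * edgeLap G (extendAux G o z g (G.dist o (ter e))) e := by
      rw [← extendAux_succ_of_notMem z g _ hm, ← hd]
    rw [hfe, mul_inv_cancel_left₀ hz]
    exact edgeLap_congr fun e' he' => by rw [← he']

/-- On a tree of bounded degree without dead ends, restriction to the
edges pointing away from `o` is a linear isomorphism between the `z`-eigenspaces of the
edge Laplacian. -/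
theorem statement5 {X : Type} (G : SimpleGraph X) (hT : G.IsTree) (hlf : LocFin G)
    (hbd : ∃ D : ℕ, ∀ x : X, deg G x ≤ D) (hnd : ∀ x : X, 2 ≤ deg G x)
    (o : X) (z : ℂ) (hz : z ≠ 0) :
    Set.BijOn (fun (f : DE G → ℂ) (e : ↥(away G o)) => f e.1)
      (edgeEig G z) (edgeEigAway G o z) := by
  refine ⟨fun f hf e => ?_, injOn_restrict_away hT o hz, surjOn_restrict_away hT o hz⟩
  rw [edgeLapAway_restrict hT o f e]
  exact hf e.1

end GraphQCC
end

section
/- Let G = (X,E) be a tree without dead ends and z ∈ ℂ ∖ {0}. Then the image of the edge Poisson transform is contained in the z-eigenspace of the edge Laplacian: for every μ ∈ D'(Ω) one has Δᵉ(P^e_z μ) = z · P^e_z μ. -/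
open Function Set
open scoped Classical

namespace GraphQCC

variable {X : Type} (G : SimpleGraph X)

variable {G}

variable (G)

/-- A vertex of a tree has at most one neighbor closer to a given vertex. -/
lemma eq_of_adj_of_dist_eq_add_one {G : SimpleGraph X} (hT : G.IsTree) {x y a b : X}
    (ha : G.Adj y a) (hb : G.Adj y b) (hda : G.dist x y = G.dist x a + 1)
    (hdb : G.dist x y = G.dist x b + 1) : a = b := by
  obtain ⟨p, hp⟩ := hT.connected.exists_walk_length_eq_dist a x
  obtain ⟨q, hq⟩ := hT.connected.exists_walk_length_eq_dist b x
  have hp' : (SimpleGraph.Walk.cons ha p).IsPath :=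
    SimpleGraph.Walk.isPath_of_length_eq_dist _ (by
      rw [SimpleGraph.Walk.length_cons, hp, SimpleGraph.dist_comm, ← hda, SimpleGraph.dist_comm])
  have hq' : (SimpleGraph.Walk.cons hb q).IsPath :=
    SimpleGraph.Walk.isPath_of_length_eq_dist _ (by
      rw [SimpleGraph.Walk.length_cons, hq, SimpleGraph.dist_comm, ← hdb, SimpleGraph.dist_comm])
  have h := congrArg SimpleGraph.Walk.snd ((hT.existsUnique_path y x).unique hp' hq')
  simpa using h

lemma Ray.dist_add_two {G : SimpleGraph X} (hT : G.IsTree) (r : Ray G) (x : X) {n : ℕ}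
    (h : G.dist x (r.1 (n + 1)) = G.dist x (r.1 n) + 1) :
    G.dist x (r.1 (n + 2)) = G.dist x (r.1 (n + 1)) + 1 := by
  rcases hT.dist_eq_dist_add_one_of_adj x (r.2.1 (n + 1)) with h' | h'
  · exact absurd (eq_of_adj_of_dist_eq_add_one hT (r.2.1 (n + 1)) (r.2.1 n).symm h' h) (r.2.2 n)
  · exact h'

lemma Ray.dist_add {G : SimpleGraph X} (hT : G.IsTree) (r : Ray G) (x : X) {N : ℕ}
    (h : G.dist x (r.1 (N + 1)) = G.dist x (r.1 N) + 1) (n : ℕ) :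
    G.dist x (r.1 (N + n)) = G.dist x (r.1 N) + n := by
  have key : ∀ n, G.dist x (r.1 (N + n + 1)) = G.dist x (r.1 (N + n)) + 1 := by
    intro n
    induction n with
    | zero => exact h
    | succ n ih => exact r.dist_add_two hT x ih
  induction n with
  | zero => simp
  | succ n ih => rw [← add_assoc, key, ih, add_assoc]

/-- The distance from a vertex eventually grows by one with each step along a ray. -/
lemma Ray.exists_dist_add {G : SimpleGraph X} (hT : G.IsTree) (r : Ray G) (x : X) :
    ∃ N, ∀ n, G.dist x (r.1 (N + n)) = G.dist x (r.1 N) + n := by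
  by_cases h : ∃ N, G.dist x (r.1 (N + 1)) = G.dist x (r.1 N) + 1
  · obtain ⟨N, hN⟩ := h
    exact ⟨N, r.dist_add hT x hN⟩
  · exfalso
    have key : ∀ n, G.dist x (r.1 n) + n = G.dist x (r.1 0) := by
      intro n
      induction n with
      | zero => simp
      | succ n ih =>
        rcases hT.dist_eq_dist_add_one_of_adj x (r.2.1 n) with h' | h'
        · omega
        · exact absurd ⟨n, h'⟩ h
    have := key (G.dist x (r.1 0) + 1)
    omega

lemma Ray.dist_zero {G : SimpleGraph X} (hT : G.IsTree) (r : Ray G) (n : ℕ) :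
    G.dist (r.1 0) (r.1 n) = n := by
  have h : G.dist (r.1 0) (r.1 (0 + 1)) = G.dist (r.1 0) (r.1 0) + 1 := by
    rw [SimpleGraph.dist_self, SimpleGraph.dist_eq_one_iff_adj.2 (r.2.1 0)]
  simpa using r.dist_add hT _ h n

/-- The ray obtained by dropping the first vertex. -/
def Ray.tail {G : SimpleGraph X} (r : Ray G) : Ray G :=
  ⟨fun n => r.1 (n + 1), fun n => r.2.1 (n + 1), fun n => r.2.2 (n + 1)⟩

lemma Ray.dist_one {G : SimpleGraph X} (hT : G.IsTree) (r : Ray G) (n : ℕ) :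
    G.dist (r.1 1) (r.1 (n + 1)) = n :=
  r.tail.dist_zero hT n

/-- Rays that agree up to a shift are equivalent. -/
lemma rayRel_of_shift {G : SimpleGraph X} (hT : G.IsTree) {r r' : Ray G} {N M : ℕ}
    (h : ∀ n, r'.1 (M + n) = r.1 (N + n)) : RayRel G r r' := by
  refine Set.infinite_of_injective_forall_mem (f := fun n => r.1 (N + n)) ?_ ?_
  · intro a b hab
    have := congrArg (G.dist (r.1 0)) hab
    simpa [r.dist_zero hT] using this
  · exact fun n => ⟨⟨_, rfl⟩, ⟨_, h n⟩⟩

/-- Every ray is equivalent to one starting at a given vertex. -/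
lemma Ray.exists_rayRel {G : SimpleGraph X} (hT : G.IsTree) (r : Ray G) (x : X) :
    ∃ r' : Ray G, r'.1 0 = x ∧ RayRel G r r' := by
  obtain ⟨N, hN⟩ := r.exists_dist_add hT x
  obtain ⟨p, hp⟩ := hT.connected.exists_walk_length_eq_dist x (r.1 N)
  let s : ℕ → X := fun n => if n ≤ p.length then p.getVert n else r.1 (N + (n - p.length))
  have hs_tail : ∀ n, s (p.length + n) = r.1 (N + n) := by
    intro n
    rcases Nat.eq_zero_or_pos n with rfl | hn
    · simp [s]
    · simp [s, hn.ne']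
  have hs_adj : ∀ n, G.Adj (s n) (s (n + 1)) := by
    intro n
    rcases lt_or_ge n p.length with hn | hn
    · have h1 : n ≤ p.length := hn.le
      have h2 : n + 1 ≤ p.length := hn
      simpa [s, h1, h2] using p.adj_getVert_succ hn
    · obtain ⟨m, rfl⟩ := Nat.exists_eq_add_of_le hn
      rw [add_assoc, hs_tail, hs_tail]
      exact r.2.1 (N + m)
  have hs_zero : s 0 = x := by simp [s]
  have hs_dist : ∀ n, G.dist x (s n) = n := by
    have hle : ∀ n, G.dist x (s n) ≤ n := by
      intro n
      induction n with
      | zero => simp [hs_zero]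
      | succ n ih =>
        rcases hT.dist_eq_dist_add_one_of_adj x (hs_adj n) with h' | h' <;> omega
    intro n
    refine le_antisymm (hle n) ?_
    have hback : ∀ m, G.dist x (s (n + m)) ≤ G.dist x (s n) + m := by
      intro m
      induction m with
      | zero => simp
      | succ m ih =>
        rw [← add_assoc]
        rcases hT.dist_eq_dist_add_one_of_adj x (hs_adj (n + m)) with h' | h' <;> omega
    have h1 := hback p.length
    rw [add_comm n, hs_tail, hN, ← hp] at h1
    omega
  refine ⟨⟨s, hs_adj, fun n h => ?_⟩, hs_zero, rayRel_of_shift hT (N := N) (M := p.length) hs_tail⟩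
  have := congrArg (G.dist x) h
  rw [hs_dist, hs_dist] at this
  omega

lemma exists_busemann {G : SimpleGraph X} (hT : G.IsTree) (x y : X) :
    ∃ b : Boundary G → ℤ, ∀ r : Ray G, ∀ᶠ n in Filter.atTop,
      (G.dist x (r.1 n) : ℤ) - G.dist y (r.1 n) = b (Quot.mk _ r) := by
  have h : ∀ r : Ray G, ∃ k : ℤ, ∃ N, ∀ n ≥ N,
      (G.dist x (r.1 n) : ℤ) - G.dist y (r.1 n) = k := by
    intro r
    obtain ⟨N, hN⟩ := r.exists_dist_add hT x
    obtain ⟨M, hM⟩ := r.exists_dist_add hT y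
    refine ⟨(G.dist x (r.1 N) : ℤ) - N - (G.dist y (r.1 M) - M), max N M, fun n hn => ?_⟩
    have h1 := hN (n - N)
    have h2 := hM (n - M)
    rw [Nat.add_sub_cancel' (le_of_max_le_left hn)] at h1
    rw [Nat.add_sub_cancel' (le_of_max_le_right hn)] at h2
    omega
  choose f N hf using h
  refine ⟨Quot.lift f fun r r' hrr' => ?_, fun r => Filter.eventually_atTop.2 ⟨N r, hf r⟩⟩
  have hfin : (r.1 '' Set.Iio (N r) ∪ r'.1 '' Set.Iio (N r')).Finite :=
    ((Set.finite_Iio _).image _).union ((Set.finite_Iio _).image _)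
  obtain ⟨v, ⟨⟨n, hn⟩, ⟨m, hm⟩⟩, hv⟩ := (hrr'.sdiff hfin).nonempty
  have hn' : N r ≤ n := by
    by_contra hlt
    exact hv (Or.inl ⟨n, not_le.1 hlt, hn⟩)
  have hm' : N r' ≤ m := by
    by_contra hlt
    exact hv (Or.inr ⟨m, not_le.1 hlt, hm⟩)
  rw [← hf r n hn', ← hf r' m hm', hn, hm]

/-- The Busemann function `lim (d(x, v) - d(y, v))` as `v` tends to a boundary point. -/
noncomputable def busemann {G : SimpleGraph X} (hT : G.IsTree) (x y : X) : Boundary G → ℤ :=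
  (exists_busemann hT x y).choose

lemma eventually_busemann {G : SimpleGraph X} (hT : G.IsTree) (x y : X) (r : Ray G) :
    ∀ᶠ n in Filter.atTop,
      (G.dist x (r.1 n) : ℤ) - G.dist y (r.1 n) = busemann hT x y (Quot.mk _ r) :=
  (exists_busemann hT x y).choose_spec r

lemma busemann_add {G : SimpleGraph X} (hT : G.IsTree) (x y w : X) (ω : Boundary G) :
    busemann hT x y ω + busemann hT y w ω = busemann hT x w ω := by
  obtain ⟨r, rfl⟩ := Quot.exists_rep ω
  obtain ⟨n, h1, h2, h3⟩ := ((eventually_busemann hT x y r).and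
    ((eventually_busemann hT y w r).and (eventually_busemann hT x w r))).exists
  rw [← h1, ← h2, ← h3]
  ring

lemma busemann_self {G : SimpleGraph X} (hT : G.IsTree) (x : X) (ω : Boundary G) :
    busemann hT x x ω = 0 := by
  have := busemann_add hT x x x ω
  omega

lemma Boundary.exists_ray {G : SimpleGraph X} (hT : G.IsTree) (ω : Boundary G) (x : X) :
    ∃ r : Ray G, Quot.mk (RayRel G) r = ω ∧ r.1 0 = x := by
  obtain ⟨r, rfl⟩ := Quot.exists_rep ω
  obtain ⟨r', h0, hr'⟩ := r.exists_rayRel hT x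
  exact ⟨r', (Quot.sound hr').symm, h0⟩

/-- The horocycle bracket is a Busemann function. -/
lemma horo_eq_busemann {G : SimpleGraph X} (hT : G.IsTree) (o x : X) (ω : Boundary G) :
    horo G o x ω = busemann hT o x ω := by
  have h : ∃ k : ℤ, ∀ r : Ray G, Quot.mk (RayRel G) r = ω → r.1 0 = o →
      ∃ N : ℕ, ∀ n : ℕ, N ≤ n → (G.dist x (r.1 n) : ℤ) = (n : ℤ) - k := by
    refine ⟨busemann hT o x ω, ?_⟩
    rintro r rfl rfl
    obtain ⟨N, hN⟩ := Filter.eventually_atTop.1 (eventually_busemann hT (r.1 0) x r)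
    refine ⟨N, fun n hn => ?_⟩
    have := hN n hn
    rw [r.dist_zero hT] at this
    omega
  rw [horo, dif_pos h]
  obtain ⟨r, rfl, rfl⟩ := ω.exists_ray hT o
  obtain ⟨N, hN⟩ := h.choose_spec r rfl rfl
  obtain ⟨n, hn, hn'⟩ :=
    ((eventually_busemann hT (r.1 0) x r).and (Filter.eventually_ge_atTop N)).exists
  have := hN n hn'
  rw [r.dist_zero hT] at hn
  omega

lemma busemann_eq_one_of_ray {G : SimpleGraph X} (hT : G.IsTree) (r : Ray G) :
    busemann hT (r.1 0) (r.1 1) (Quot.mk _ r) = 1 := by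
  obtain ⟨n, hn, hn'⟩ := ((eventually_busemann hT (r.1 0) (r.1 1) r).and
    (Filter.eventually_ge_atTop 1)).exists
  obtain ⟨m, rfl⟩ := Nat.exists_eq_add_of_le' hn'
  rw [r.dist_zero hT, r.dist_one hT] at hn
  omega

/-- Two neighbors of `x` that both lie in the direction of `ω` coincide. -/
lemma eq_of_busemann_eq_one {G : SimpleGraph X} (hT : G.IsTree) {x a b : X} {ω : Boundary G}
    (ha : G.Adj x a) (hb : G.Adj x b) (hωa : busemann hT x a ω = 1)
    (hωb : busemann hT x b ω = 1) : a = b := by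
  obtain ⟨r, rfl⟩ := Quot.exists_rep ω
  obtain ⟨n, h1, h2⟩ :=
    ((eventually_busemann hT x a r).and (eventually_busemann hT x b r)).exists
  refine eq_of_adj_of_dist_eq_add_one hT (x := r.1 n) ha hb ?_ ?_
  · rw [SimpleGraph.dist_comm, SimpleGraph.dist_comm (v := a)]
    omega
  · rw [SimpleGraph.dist_comm, SimpleGraph.dist_comm (v := b)]
    omega

lemma mem_plusBd_iff {G : SimpleGraph X} (hT : G.IsTree) (e : DE G) (ω : Boundary G) :
    ω ∈ plusBd G e ↔ busemann hT (ini e) (ter e) ω = 1 := by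
  constructor
  · rintro ⟨r, rfl, h0, h1⟩
    rw [← h0, ← h1]
    exact busemann_eq_one_of_ray hT r
  · intro h
    obtain ⟨r, rfl, h0⟩ := ω.exists_ray hT (ini e)
    refine ⟨r, rfl, h0, ?_⟩
    have h1 := busemann_eq_one_of_ray hT r
    have h2 := r.2.1 0
    rw [h0] at h1 h2
    exact eq_of_busemann_eq_one hT h2 e.2 h1 h

lemma busemann_eq_neg_one {G : SimpleGraph X} (hT : G.IsTree) {e : DE G} {ω : Boundary G}
    (h : ω ∉ plusBd G e) : busemann hT (ini e) (ter e) ω = -1 := by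
  rw [mem_plusBd_iff hT] at h
  obtain ⟨r, rfl⟩ := Quot.exists_rep ω
  obtain ⟨n, hn⟩ := (eventually_busemann hT (ini e) (ter e) r).exists
  have hadj : G.Adj (ini e) (ter e) := e.2
  have := hT.dist_eq_dist_add_one_of_adj (r.1 n) hadj
  rw [SimpleGraph.dist_comm, SimpleGraph.dist_comm (v := ter e)] at this
  omega

/-- The boundary is the disjoint union of `∂₊ e` and `∂₊ (op e)`. -/
lemma mem_plusBd_op_iff {G : SimpleGraph X} (hT : G.IsTree) (e : DE G) (ω : Boundary G) :
    ω ∈ plusBd G (op e) ↔ ω ∉ plusBd G e := by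
  have h := busemann_add hT (ini e) (ter e) (ini e) ω
  rw [busemann_self] at h
  have hop : ω ∈ plusBd G (op e) ↔ busemann hT (ter e) (ini e) ω = 1 :=
    mem_plusBd_iff hT (op e) ω
  constructor
  · intro h1 h2
    rw [hop] at h1
    rw [mem_plusBd_iff hT] at h2
    omega
  · intro h1
    rw [hop]
    have := busemann_eq_neg_one hT h1
    omega

/-- Exactly one edge starting at `x` points towards `ω`. -/
lemma existsUnique_edge {G : SimpleGraph X} (hT : G.IsTree) (x : X) (ω : Boundary G) :
    ∃! e : DE G, ini e = x ∧ ω ∈ plusBd G e := by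
  obtain ⟨r, hr, h0⟩ := ω.exists_ray hT x
  let e₀ : DE G := ⟨(r.1 0, r.1 1), r.2.1 0⟩
  have he₀ : ω ∈ plusBd G e₀ := ⟨r, hr, rfl, rfl⟩
  refine ⟨e₀, ⟨h0, he₀⟩, fun e ⟨hx, he⟩ => ?_⟩
  have hini : ini e = ini e₀ := hx.trans h0.symm
  have hadj : G.Adj (ini e) (ter e) := e.2
  rw [mem_plusBd_iff hT] at he he₀
  rw [hini] at hadj he
  exact Subtype.ext (Prod.ext hini (eq_of_busemann_eq_one hT hadj e₀.2 he he₀))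

lemma isOpen_plusBd {G : SimpleGraph X} (e : DE G) : IsOpen (plusBd G e) :=
  TopologicalSpace.isOpen_generateFrom_of_mem ⟨e, rfl⟩

lemma isLocallyConstant_busemann {G : SimpleGraph X} (hT : G.IsTree) (x y : X) :
    IsLocallyConstant (busemann hT x y) := by
  have hadj : ∀ {a b : X}, G.Adj a b → IsLocallyConstant (busemann hT a b) := by
    intro a b hab
    let e : DE G := ⟨(a, b), hab⟩
    rw [IsLocallyConstant.iff_exists_open]
    intro ω
    by_cases hω : ω ∈ plusBd G e
    · refine ⟨plusBd G e, isOpen_plusBd e, hω, fun η hη => ?_⟩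
      exact ((mem_plusBd_iff hT e η).1 hη).trans ((mem_plusBd_iff hT e ω).1 hω).symm
    · refine ⟨plusBd G (op e), isOpen_plusBd _, (mem_plusBd_op_iff hT e ω).2 hω, fun η hη => ?_⟩
      exact (busemann_eq_neg_one hT ((mem_plusBd_op_iff hT e η).1 hη)).trans
        (busemann_eq_neg_one hT hω).symm
  obtain ⟨p⟩ := hT.connected x y
  induction p with
  | nil => exact IsLocallyConstant.of_constant _ fun _ _ => by simp [busemann_self]
  | cons h _ ih =>
    rw [← funext (busemann_add hT _ _ _)]
    exact (hadj h).add ih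

lemma isLocallyConstant_poissonKernel {G : SimpleGraph X} (hT : G.IsTree) (o : X) (z : ℂ)
    (e : DE G) :
    IsLocallyConstant fun ω => z ^ horo G o (ini e) ω * Set.indicator (plusBd G e) 1 ω := by
  have h := (isLocallyConstant_busemann hT o (ini e)).comp₂
    (isLocallyConstant_busemann hT (ini e) (ter e))
    (fun k l : ℤ => z ^ k * if l = 1 then (1 : ℂ) else 0)
  convert h using 4 with ω
  · exact horo_eq_busemann hT o (ini e) ω
  · simp [Set.indicator_apply, mem_plusBd_iff hT]

/-- The kernel of the edge Poisson transform is an eigenfunction of the edge Laplacian. -/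
lemma sum_poissonKernel {G : SimpleGraph X} (hT : G.IsTree) (o : X) {z : ℂ} (hz : z ≠ 0)
    (e : DE G) (S : Finset (DE G)) (hS : ∀ e', e' ∈ S ↔ ini e' = ter e ∧ e' ≠ op e)
    (ω : Boundary G) :
    ∑ e' ∈ S, z ^ horo G o (ini e') ω * Set.indicator (plusBd G e') 1 ω =
      z * (z ^ horo G o (ini e) ω * Set.indicator (plusBd G e) 1 ω) := by
  obtain ⟨e₀, ⟨h₀, hω₀⟩, huniq⟩ := existsUnique_edge hT (ter e) ω
  by_cases hω : ω ∈ plusBd G e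
  · have hmem : e₀ ∈ S := by
      rw [hS]
      refine ⟨h₀, ?_⟩
      rintro rfl
      exact (mem_plusBd_op_iff hT e ω).1 hω₀ hω
    rw [Finset.sum_eq_single_of_mem e₀ hmem]
    · rw [Set.indicator_of_mem hω₀, Set.indicator_of_mem hω, h₀, horo_eq_busemann hT,
        horo_eq_busemann hT, ← busemann_add hT o (ini e) (ter e), (mem_plusBd_iff hT e ω).1 hω,
        zpow_add_one₀ hz]
      simp only [Pi.one_apply]
      ring
    · intro e' he' hne
      rw [Set.indicator_of_notMem, mul_zero]
      exact fun h => hne (huniq e' ⟨((hS e').1 he').1, h⟩)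
  · rw [Set.indicator_of_notMem hω, mul_zero, mul_zero]
    refine Finset.sum_eq_zero fun e' he' => ?_
    rw [Set.indicator_of_notMem, mul_zero]
    intro h
    obtain ⟨h1, h2⟩ := (hS e').1 he'
    exact h2 ((huniq e' ⟨h1, h⟩).trans
      (huniq (op e) ⟨rfl, (mem_plusBd_op_iff hT e ω).2 hω⟩).symm)

lemma edgePoisson_eq {G : SimpleGraph X} (hT : G.IsTree) (o : X) (z : ℂ) (μ : DualB G)
    (e : DE G) :
    edgePoisson G o z μ e = μ ⟨_, isLocallyConstant_poissonKernel hT o z e⟩ :=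
  dif_pos _

/-- The image of the edge Poisson transform consists of eigenfunctions of
the edge Laplacian with eigenvalue `z`. -/
theorem statement6 {X : Type} (G : SimpleGraph X) (hT : G.IsTree) (hlf : LocFin G)
    (hnd : ∀ x : X, 2 ≤ deg G x) (o : X) (z : ℂ) (hz : z ≠ 0) (μ : DualB G) :
    ∀ e : DE G, edgeLap G (edgePoisson G o z μ) e = z * edgePoisson G o z μ e := by
  intro e
  have hfin : {e' : DE G | ini e' = ter e ∧ e' ≠ op e}.Finite :=
    (hlf (ter e)).subset fun _ h => h.1
  rw [edgeLap, finsum_mem_eq_finite_toFinset_sum _ hfin]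
  simp only [edgePoisson_eq hT]
  rw [← map_sum, ← smul_eq_mul, ← map_smul]
  congr 1
  ext ω
  have h := sum_poissonKernel hT o hz e hfin.toFinset (fun e' => by simp) ω
  simpa [Finset.sum_apply] using h

end GraphQCC
end
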